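/- Let L be a simple graph with vertex set V and let A_L be the associated right-angled Artin group. Let x, y ∈ A_L be elements such that the homomorphism from the free group F₂ on two generators to A_L sending the two free generators to x and y respectively is injective (so x and y generate a free subgroup of rank 2). Then there exists an element w of the subgroup generated by x and y with w ≠ 1 such that the cyclic subgroups ⟨x⟩ and ⟨w⟩ have disjoint conjugates in A_L. -/

import Mathlib

/-- Two subgroups `H₀` and `H₁` of a group `G` have *disjoint conjugates* if
`g H₀ g⁻¹ ∩ H₁ = {1}` for every `g ∈ G`. -/
def DisjointConjugates {G : Type*} [Group G] (H₀ H₁ : Subgroup G) : Prop :=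
  ∀ g : G, ∀ h ∈ H₀, g * h * g⁻¹ ∈ H₁ → h = 1

/-- The commutator relators of the right-angled Artin group of a simple graph `L`:
for each edge `{v, w}` of `L`, the commutator `v * w * v⁻¹ * w⁻¹`. -/
def raagRels {V : Type*} (L : SimpleGraph V) : Set (FreeGroup V) :=
  {r | ∃ v w : V, L.Adj v w ∧
    r = FreeGroup.of v * FreeGroup.of w * (FreeGroup.of v)⁻¹ * (FreeGroup.of w)⁻¹}

/-- The right-angled Artin group associated to a simple graph `L`. -/
abbrev RAAG {V : Type*} (L : SimpleGraph V) : Type _ := PresentedGroup (raagRels L)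

open Polynomial

namespace RaagAux

section Poly

variable {A : Type*} [Ring A]

lemma dvd_mul_X {a b : ℕ} {p q : A[X]} (hp : X ^ a ∣ p) (hq : X ^ b ∣ q) :
    X ^ (a + b) ∣ p * q := by
  obtain ⟨c, rfl⟩ := hp
  obtain ⟨e, rfl⟩ := hq
  refine ⟨c * e, ?_⟩
  rw [pow_add, mul_assoc, ← mul_assoc c, ← X_pow_mul (n := b) (p := c)]
  simp only [mul_assoc]

lemma dvd_mul_left_X {a : ℕ} {p : A[X]} (q : A[X]) (hp : X ^ a ∣ p) : X ^ a ∣ q * p := by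
  have h := dvd_mul_X (a := 0) (p := q) (by simp) hp
  simpa using h

/-- Units congruent to one modulo the `d`-th power of `X`. -/
def D (A : Type*) [Ring A] (d : ℕ) : Subgroup (A[X])ˣ where
  carrier := {u | X ^ d ∣ (u : A[X]) - 1}
  one_mem' := by simp
  mul_mem' := by
    intro u v hu hv
    have : ((u * v : (A[X])ˣ) : A[X]) - 1 = u * ((v : A[X]) - 1) + ((u : A[X]) - 1) := by
      push_cast; noncomm_ring
    simp only [Set.mem_ofPred_eq] at *
    rw [this]
    exact dvd_add (dvd_mul_left_X _ hv) hu
  inv_mem' := by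
    intro u hu
    have : ((u⁻¹ : (A[X])ˣ) : A[X]) - 1 = -((u⁻¹ : (A[X])ˣ) : A[X]) * ((u : A[X]) - 1) := by
      rw [mul_sub, neg_mul, Units.inv_mul]; noncomm_ring
    simp only [Set.mem_ofPred_eq] at *
    rw [this]
    exact dvd_mul_left_X _ hu

lemma mem_D {d : ℕ} {u : (A[X])ˣ} : u ∈ D A d ↔ X ^ d ∣ (u : A[X]) - 1 := Iff.rfl

lemma D_conj {d : ℕ} {u : (A[X])ˣ} (g : (A[X])ˣ) (hu : g * u * g⁻¹ ∈ D A d) : u ∈ D A d := by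
  rw [mem_D] at *
  have : (u : A[X]) - 1 = (g⁻¹ : (A[X])ˣ) * (((g * u * g⁻¹ : (A[X])ˣ) : A[X]) - 1) * g := by
    push_cast
    simp [mul_sub, sub_mul, mul_assoc]
  rw [this]
  exact Dvd.dvd.mul_right (dvd_mul_left_X _ hu) _

lemma D_comm {d : ℕ} {u v : (A[X])ˣ} (hu : u ∈ D A d) (hv : v ∈ D A 1) :
    u * v * u⁻¹ * v⁻¹ ∈ D A (d + 1) := by
  rw [mem_D] at *
  have : ((u * v * u⁻¹ * v⁻¹ : (A[X])ˣ) : A[X]) - 1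
      = (((u : A[X]) - 1) * ((v : A[X]) - 1) - ((v : A[X]) - 1) * ((u : A[X]) - 1))
        * ((u⁻¹ : (A[X])ˣ) * (v⁻¹ : (A[X])ˣ)) := by
    have h1 : ((u : A[X]) - 1) * ((v : A[X]) - 1) - ((v : A[X]) - 1) * ((u : A[X]) - 1)
      = (u : A[X]) * v - v * u := by noncomm_ring
    rw [h1]
    simp [sub_mul, mul_assoc]
  rw [this]
  refine Dvd.dvd.mul_right (dvd_sub (dvd_mul_X hu hv) ?_) _
  rw [add_comm]
  exact dvd_mul_X hv hu

lemma D_pow {d : ℕ} {u : (A[X])ˣ} (hu : u ∈ D A d) (hu1 : u ∈ D A 1) (n : ℕ) :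
    X ^ (d + 1) ∣ (u : A[X]) ^ n - 1 - (n : A[X]) * ((u : A[X]) - 1) := by
  induction n with
  | zero => simp
  | succ n ih =>
    have : (u : A[X]) ^ (n + 1) - 1 - ((n + 1 : ℕ) : A[X]) * ((u : A[X]) - 1)
      = u * ((u : A[X]) ^ n - 1 - (n : A[X]) * ((u : A[X]) - 1))
        + n * (((u : A[X]) - 1) * ((u : A[X]) - 1)) := by
      have hc : (u : A[X]) * (n : A[X]) = n * u := (Nat.cast_commute n (u : A[X])).symm
      rw [pow_succ', mul_sub, mul_sub, ← mul_assoc (u : A[X]) (n : A[X]), hc]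
      push_cast
      noncomm_ring
    rw [this]
    exact dvd_add (dvd_mul_left_X _ ih) (dvd_mul_left_X _ (dvd_mul_X hu hu1))

lemma D_zpow [Algebra ℚ A] {d : ℕ} {u : (A[X])ˣ} (hu : u ∈ D A d) (hu1 : u ∈ D A 1)
    (hc : ((u : A[X]) - 1).coeff d ≠ 0) (n : ℤ) (h : u ^ n ∈ D A (d + 1)) : n = 0 := by
  have key : ∀ m : ℕ, u ^ m ∈ D A (d + 1) → m = 0 := by
    intro m hm
    rw [mem_D] at hm
    have h2 := dvd_sub hm (by simpa using D_pow hu hu1 m)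
    rw [Units.val_pow_eq_pow_val, sub_sub_cancel] at h2
    have h3 := (X_pow_dvd_iff.1 h2) d (Nat.lt_succ_self d)
    have h4 : (m : ℚ) • ((u : A[X]) - 1).coeff d = 0 := by
      rw [← h3, ← C_eq_natCast, coeff_C_mul, Algebra.smul_def]
      simp
    have := (smul_eq_zero.1 h4).resolve_right hc
    exact_mod_cast this
  obtain ⟨m, rfl | rfl⟩ := n.eq_nat_or_neg
  · rw [zpow_natCast] at h
    simp [key m h]
  · rw [zpow_neg, inv_mem_iff, zpow_natCast] at h
    simp [key m h]

lemma exists_deg {u : (A[X])ˣ} (h : u ≠ 1) :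
    ∃ d, u ∈ D A d ∧ ((u : A[X]) - 1).coeff d ≠ 0 := by
  have h0 : (u : A[X]) - 1 ≠ 0 := by
    intro h'
    exact h (Units.ext (by simpa using sub_eq_zero.1 h'))
  refine ⟨((u : A[X]) - 1).natTrailingDegree, ?_, ?_⟩
  · rw [mem_D, X_pow_dvd_iff]
    intro k hk
    exact coeff_eq_zero_of_lt_natTrailingDegree hk
  · exact mt trailingCoeff_eq_zero.1 h0

/-- The unit `1 + a X` for `a` of square zero. -/
noncomputable def un (a : A) (h : a * a = 0) : (A[X])ˣ where
  val := 1 + C a * X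
  inv := 1 - C a * X
  val_inv := by
    have : C a * X * (C a * X) = (0 : A[X]) := by
      rw [mul_assoc, ← mul_assoc X, X_mul_C, mul_assoc, ← mul_assoc (C a), ← C_mul, h]; simp
    have h2 : (1 + C a * X) * (1 - C a * X) = 1 - C a * X * (C a * X) := by noncomm_ring
    rw [h2, this, sub_zero]
  inv_val := by
    have : C a * X * (C a * X) = (0 : A[X]) := by
      rw [mul_assoc, ← mul_assoc X, X_mul_C, mul_assoc, ← mul_assoc (C a), ← C_mul, h]; simp
    have h2 : (1 - C a * X) * (1 + C a * X) = 1 - C a * X * (C a * X) := by noncomm_ring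
    rw [h2, this, sub_zero]

lemma un_mul (a b : A) (ha : a * a = 0) (hb : b * b = 0) :
    ((un a ha * un b hb : (A[X])ˣ) : A[X]) = 1 + C (a + b) * X + C (a * b) * X ^ 2 := by
  have : C a * X * (C b * X) = (C (a * b) * X ^ 2 : A[X]) := by
    rw [mul_assoc, ← mul_assoc X, X_mul_C, C_mul, pow_two]; simp only [mul_assoc]
  push_cast
  simp only [un]
  rw [← this, C_add]
  noncomm_ring

lemma un_zpow [Algebra ℚ A] (a : A) (h : a * a = 0) (n : ℤ) :
    ((un a h ^ n : (A[X])ˣ) : A[X]) = 1 + C ((n : ℚ) • a) * X := by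
  have hs : ∀ r : ℚ, (r • a) * (r • a) = 0 := by intro r; simp [h]
  have key : un a h ^ n = un ((n : ℚ) • a) (hs n) := by
    induction n with
    | zero => ext1; simp [un]
    | succ i ih =>
      rw [zpow_add_one, ih]
      apply Units.ext
      rw [un_mul]
      simp [un, h, add_smul]
    | pred i ih =>
      rw [zpow_sub_one, ih, mul_inv_eq_iff_eq_mul]
      apply Units.ext
      have h0 : ((((-(i : ℤ) - 1 : ℤ) : ℚ)) • a) * a = 0 := by rw [smul_mul_assoc, h, smul_zero]
      rw [un_mul, h0]
      simp [un, sub_smul]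
  rw [key]
  rfl

lemma coeff_prod_un (l : List A) :
    (l.map fun a => (1 + C a * X : A[X])).prod.natDegree ≤ l.length ∧
    (l.map fun a => (1 + C a * X : A[X])).prod.coeff l.length = l.prod := by
  induction l with
  | nil => simp
  | cons a l ih =>
    have h1 : (1 + C a * X : A[X]).natDegree ≤ 1 := by compute_degree
    simp only [List.map_cons, List.prod_cons, List.length_cons]
    rw [add_comm l.length 1]
    refine ⟨natDegree_mul_le_of_le h1 ih.1, ?_⟩
    rw [coeff_mul_add_eq_of_natDegree_le h1 ih.1, ih.2]
    simp [coeff_one]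

end Poly

section Raag

variable {V : Type*} (L : SimpleGraph V)

/-- Functions on words, invariant under allowed swaps and vanishing on words with squares. -/
def W : Submodule ℚ (List V → ℚ) where
  carrier := {f | (∀ a b v w, L.Adj v w → f (a ++ v :: w :: b) = f (a ++ w :: v :: b)) ∧
    ∀ a b v, f (a ++ v :: v :: b) = 0}
  add_mem' := by
    rintro f g ⟨hf, hf'⟩ ⟨hg, hg'⟩
    refine ⟨fun a b v w h => ?_, fun a b v => ?_⟩
    · simp [hf a b v w h, hg a b v w h]
    · simp [hf', hg']
  zero_mem' := by simp
  smul_mem' := by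
    rintro c f ⟨hf, hf'⟩
    refine ⟨fun a b v w h => ?_, fun a b v => ?_⟩
    · simp [hf a b v w h]
    · simp [hf']

def T (v : V) : Module.End ℚ (W L) where
  toFun f := ⟨fun l => f.1 (l ++ [v]), by
    refine ⟨fun a b u w h => ?_, fun a b u => ?_⟩
    · simpa using f.2.1 a (b ++ [v]) u w h
    · simpa using f.2.2 a (b ++ [v]) u⟩
  map_add' f g := by ext; simp
  map_smul' c f := by ext; simp

lemma T_apply (v : V) (f : W L) (l : List V) : (T L v f).1 l = f.1 (l ++ [v]) := rfl

lemma T_sq (v : V) : T L v * T L v = 0 := by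
  ext f l
  simpa [T_apply] using f.2.2 l [] v

lemma T_comm {v w : V} (h : L.Adj v w) : T L v * T L w = T L w * T L v := by
  ext f l
  simpa [T_apply] using f.2.1 l [] v w h

lemma T_prod (s : List V) (f : W L) (l : List V) :
    ((s.map (T L)).prod f).1 l = f.1 (l ++ s) := by
  induction s generalizing l with
  | nil => simp
  | cons v s ih => simp [T_apply, ih]

/-- One swap. -/
def Swap (s t : List V) : Prop :=
  ∃ a b v w, L.Adj v w ∧ s = a ++ v :: w :: b ∧ t = a ++ w :: v :: b

lemma T_prod_ne_zero (s : List V)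
    (h : ∀ a b v, ¬ Relation.EqvGen (Swap L) s (a ++ v :: v :: b)) :
    (s.map (T L)).prod ≠ 0 := by
  classical
  intro h0
  let f : W L := ⟨fun l => if Relation.EqvGen (Swap L) s l then 1 else 0, by
    refine ⟨fun a b v w hvw => ?_, fun a b v => ?_⟩
    · have h1 : Relation.EqvGen (Swap L) (a ++ v :: w :: b) (a ++ w :: v :: b) :=
        .rel _ _ ⟨a, b, v, w, hvw, rfl, rfl⟩
      have : Relation.EqvGen (Swap L) s (a ++ v :: w :: b) ↔
          Relation.EqvGen (Swap L) s (a ++ w :: v :: b) :=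
        ⟨fun h => h.trans _ _ _ h1, fun h => h.trans _ _ _ (h1.symm _ _)⟩
      simp only [this]
    · simp only [h a b v, if_false]⟩
  have h1 := T_prod L s f []
  rw [h0] at h1
  have h2 : f.1 s = 1 := if_pos (Relation.EqvGen.refl s)
  rw [List.nil_append, h2] at h1
  simp at h1

/-- The Magnus-type representation. -/
noncomputable def mu : RAAG L →* ((Module.End ℚ (W L))[X])ˣ :=
  PresentedGroup.toGroup (f := fun v => un (T L v) (T_sq L v)) (by
    rintro r ⟨v, w, h, rfl⟩
    simp only [map_mul, map_inv, FreeGroup.lift_apply_of]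
    rw [mul_inv_eq_one, mul_inv_eq_iff_eq_mul]
    apply Units.ext
    rw [un_mul, un_mul, T_comm L h, add_comm (T L v)])

lemma mu_of (v : V) : mu L (PresentedGroup.of v) = un (T L v) (T_sq L v) := by
  simp [mu]

lemma mu_mem (g : RAAG L) : mu L g ∈ D (Module.End ℚ (W L)) 1 := by
  have : (⊤ : Subgroup (RAAG L)) ≤ (D (Module.End ℚ (W L)) 1).comap (mu L) := by
    rw [← PresentedGroup.closure_range_of, Subgroup.closure_le]
    rintro _ ⟨v, rfl⟩
    change mu L (PresentedGroup.of v) ∈ D (Module.End ℚ (W L)) 1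
    rw [mu_of, mem_D]
    refine ⟨C (T L v), ?_⟩
    simp [un, X_mul_C]
  exact this (Subgroup.mem_top g)

/-- Evaluation of a syllable word. -/
def ev (s : List (V × ℤ)) : RAAG L :=
  (s.map fun p => (PresentedGroup.of p.1 : RAAG L) ^ p.2).prod

lemma ev_append (s t : List (V × ℤ)) : ev L (s ++ t) = ev L s * ev L t := by
  simp [ev]

lemma ev_cons (p : V × ℤ) (t : List (V × ℤ)) :
    ev L (p :: t) = (PresentedGroup.of p.1 : RAAG L) ^ p.2 * ev L t := by
  simp [ev]

/-- `s` is a syllable word for `g`. -/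
def Rep (g : RAAG L) (s : List (V × ℤ)) : Prop := ev L s = g ∧ ∀ p ∈ s, p.2 ≠ 0

lemma exists_rep (g : RAAG L) : ∃ s, Rep L g s := by
  have hg : g ∈ Subgroup.closure (Set.range (PresentedGroup.of : V → RAAG L)) := by
    rw [PresentedGroup.closure_range_of]; trivial
  induction hg using Subgroup.closure_induction with
  | mem x hx =>
    obtain ⟨v, rfl⟩ := hx
    exact ⟨[(v, 1)], by simp [ev], by simp⟩
  | one => exact ⟨[], by simp [ev], by simp⟩
  | mul x y _ _ hx hy =>
    obtain ⟨s, hs, hs'⟩ := hx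
    obtain ⟨t, ht, ht'⟩ := hy
    refine ⟨s ++ t, by rw [ev_append, hs, ht], ?_⟩
    intro p hp
    rcases List.mem_append.1 hp with h | h
    · exact hs' p h
    · exact ht' p h
  | inv x _ hx =>
    obtain ⟨s, hs, hs'⟩ := hx
    refine ⟨(s.map fun p => (p.1, -p.2)).reverse, ?_, ?_⟩
    · rw [← hs]
      clear hs hs'
      induction s with
      | nil => simp [ev]
      | cons p s ih =>
        rw [List.map_cons, List.reverse_cons, ev_append, ih, ev_cons]
        simp [ev]
    · intro p hp
      simp only [List.mem_reverse, List.mem_map] at hp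
      obtain ⟨q, hq, rfl⟩ := hp
      simpa using hs' q hq

lemma of_comm {v w : V} (h : L.Adj v w) :
    Commute (PresentedGroup.of v : RAAG L) (PresentedGroup.of w) := by
  have := PresentedGroup.one_of_mem (rels := raagRels L) ⟨v, w, h, rfl⟩
  simp only [map_mul, map_inv] at this
  rw [mul_inv_eq_one, mul_inv_eq_iff_eq_mul] at this
  exact this

lemma split_map {s : List (V × ℤ)} {a b : List V} {v w : V}
    (h : s.map Prod.fst = a ++ v :: w :: b) :
    ∃ sa e f sb, s = sa ++ (v, e) :: (w, f) :: sb ∧ sa.map Prod.fst = a ∧ sb.map Prod.fst = b := by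
  obtain ⟨sa, t, rfl, ha, ht⟩ := List.map_eq_append_iff.1 h
  obtain ⟨p, t', rfl, hp, ht'⟩ := List.map_eq_cons_iff.1 ht
  obtain ⟨q, sb, rfl, hq, hb⟩ := List.map_eq_cons_iff.1 ht'
  subst hp hq
  exact ⟨sa, p.2, q.2, sb, rfl, ha, hb⟩

lemma rep_swap {g : RAAG L} {a b : List V} {v w : V} (h : L.Adj v w)
    (hs : ∃ s, Rep L g s ∧ s.map Prod.fst = a ++ v :: w :: b) :
    ∃ s, Rep L g s ∧ s.map Prod.fst = a ++ w :: v :: b := by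
  obtain ⟨s, ⟨hs, hs'⟩, hm⟩ := hs
  obtain ⟨sa, e, f, sb, rfl, rfl, rfl⟩ := split_map hm
  refine ⟨sa ++ (w, f) :: (v, e) :: sb, ⟨?_, ?_⟩, by simp⟩
  · rw [← hs]
    simp only [ev_append, ev_cons]
    rw [← mul_assoc (_ ^ f), ← mul_assoc (_ ^ e), ((of_comm L h).zpow_zpow e f).eq]
  · intro p hp
    apply hs' p
    simp only [List.mem_append, List.mem_cons] at hp ⊢
    tauto

lemma rep_eqv {g : RAAG L} {l l' : List V} (h : Relation.EqvGen (Swap L) l l') :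
    (∃ s, Rep L g s ∧ s.map Prod.fst = l) ↔ (∃ s, Rep L g s ∧ s.map Prod.fst = l') := by
  induction h with
  | rel x y h =>
    obtain ⟨a, b, v, w, h, rfl, rfl⟩ := h
    exact ⟨rep_swap L h, rep_swap L h.symm⟩
  | refl x => exact Iff.rfl
  | symm x y _ ih => exact ih.symm
  | trans x y z _ _ h1 h2 => exact h1.trans h2

lemma rep_square {g : RAAG L} {s : List (V × ℤ)} (hs : Rep L g s) {a b : List V} {v : V}
    (hm : s.map Prod.fst = a ++ v :: v :: b) : ∃ t, Rep L g t ∧ t.length < s.length := by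
  obtain ⟨hs, hs'⟩ := hs
  obtain ⟨sa, e, f, sb, rfl, rfl, rfl⟩ := split_map hm
  by_cases hef : e + f = 0
  · refine ⟨sa ++ sb, ⟨?_, ?_⟩, by simp⟩
    · rw [← hs]
      simp only [ev_append, ev_cons]
      rw [← mul_assoc (_ ^ e), ← zpow_add, hef]
      simp
    · intro p hp
      apply hs' p
      simp only [List.mem_append, List.mem_cons] at hp ⊢
      tauto
  · refine ⟨sa ++ (v, e + f) :: sb, ⟨?_, ?_⟩, by simp⟩
    · rw [← hs]
      simp only [ev_append, ev_cons]
      rw [← mul_assoc (_ ^ e), ← zpow_add]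
    · intro p hp
      simp only [List.mem_append, List.mem_cons] at hp
      rcases hp with h | rfl | h
      · exact hs' p (by simp [h])
      · exact hef
      · exact hs' p (by simp [h])

lemma mu_ev (s : List (V × ℤ)) : ((mu L (ev L s) : ((Module.End ℚ (W L))[X])ˣ) :
    (Module.End ℚ (W L))[X]) =
    ((s.map fun p => (p.2 : ℚ) • T L p.1).map fun a => 1 + C a * X).prod := by
  induction s with
  | nil => simp [ev]
  | cons p s ih =>
    rw [ev_cons, map_mul, Units.val_mul, ih, map_zpow, mu_of, un_zpow]
    simp

lemma prod_smul_T (s : List (V × ℤ)) : (s.map fun p => (p.2 : ℚ) • T L p.1).prod =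
    (s.map fun p => (p.2 : ℚ)).prod • ((s.map Prod.fst).map (T L)).prod := by
  induction s with
  | nil => simp
  | cons p s ih =>
    simp only [List.map_cons, List.prod_cons, ih]
    rw [smul_mul_smul_comm]

lemma mu_ne_one {g : RAAG L} (hg : g ≠ 1) : mu L g ≠ 1 := by
  classical
  have hex : ∃ n s, Rep L g s ∧ s.length = n := by
    obtain ⟨s, hs⟩ := exists_rep L g
    exact ⟨_, s, hs, rfl⟩
  obtain ⟨s, hs, hn⟩ := Nat.find_spec hex
  have hmin : ∀ t, Rep L g t → s.length ≤ t.length := by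
    intro t ht
    rw [hn]
    exact Nat.find_min' hex ⟨t, ht, rfl⟩
  have hT : ((s.map Prod.fst).map (T L)).prod ≠ 0 := by
    apply T_prod_ne_zero
    intro a b v hE
    obtain ⟨t, ht, htm⟩ := (rep_eqv L hE).1 ⟨s, hs, rfl⟩
    obtain ⟨r, hr, hlt⟩ := rep_square L ht htm
    have h1 := hmin r hr
    have h2 : (s.map Prod.fst).length = (a ++ v :: v :: b).length := by
      have key : ∀ l l', Relation.EqvGen (Swap L) l l' → l.length = l'.length := by
        intro l l' h
        induction h with
        | rel x y h => obtain ⟨a, b, v, w, h, rfl, rfl⟩ := h; simp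
        | refl x => rfl
        | symm x y _ ih => exact ih.symm
        | trans x y z _ _ h1 h2 => exact h1.trans h2
      exact key _ _ hE
    rw [← htm] at h2
    simp only [List.length_map] at h2
    omega
  have hpos : s.length ≠ 0 := by
    intro h0
    apply hg
    rw [← hs.1, List.length_eq_zero_iff.1 h0]
    simp [ev]
  intro h1
  have h2 := (coeff_prod_un (s.map fun p => (p.2 : ℚ) • T L p.1)).2
  rw [← mu_ev, hs.1, h1, prod_smul_T, List.length_map, Units.val_one, coeff_one, if_neg hpos] at h2
  rcases smul_eq_zero.1 h2.symm with h | h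
  · rw [List.prod_eq_zero_iff] at h
    obtain ⟨p, hp, hp0⟩ := List.mem_map.1 h
    exact hs.2 p hp (by exact_mod_cast hp0)
  · exact hT h

end Raag

end RaagAux

open RaagAux in
theorem stmt7 {V : Type*} (L : SimpleGraph V) (x y : RAAG L)
    (hxy : Function.Injective (FreeGroup.lift (![x, y] : Fin 2 → RAAG L))) :
    ∃ w ∈ Subgroup.closure ({x, y} : Set (RAAG L)), w ≠ 1 ∧
      DisjointConjugates (Subgroup.zpowers x) (Subgroup.zpowers w) := by
  have hx : x ∈ Subgroup.closure ({x, y} : Set (RAAG L)) := Subgroup.subset_closure (by simp)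
  have hy : y ∈ Subgroup.closure ({x, y} : Set (RAAG L)) := Subgroup.subset_closure (by simp)
  have hw : x * y * x⁻¹ * y⁻¹ ≠ 1 := by
    intro h
    have h1 : (FreeGroup.of 0 * FreeGroup.of 1 * (FreeGroup.of 0)⁻¹ * (FreeGroup.of 1)⁻¹ :
        FreeGroup (Fin 2)) = 1 := by
      apply hxy
      simpa using h
    revert h1
    decide
  have hx1 : x ≠ 1 := by
    rintro rfl
    simp at hw
  refine ⟨x * y * x⁻¹ * y⁻¹, mul_mem (mul_mem (mul_mem hx hy) (inv_mem hx)) (inv_mem hy), hw, ?_⟩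
  obtain ⟨d, hd, hc⟩ := exists_deg (A := Module.End ℚ (W L)) (u := mu L x) (mu_ne_one L hx1)
  rintro g _ ⟨n, rfl⟩ ⟨m, hm⟩
  have h1 : mu L (x * y * x⁻¹ * y⁻¹) ∈ D (Module.End ℚ (W L)) (d + 1) := by
    rw [map_mul, map_mul, map_mul, map_inv, map_inv]
    exact D_comm hd (mu_mem L y)
  have h2 := zpow_mem h1 m
  rw [← map_zpow] at h2
  have hm' : (x * y * x⁻¹ * y⁻¹) ^ m = g * x ^ n * g⁻¹ := hm
  rw [hm', map_mul, map_mul, map_inv, map_zpow] at h2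
  have h3 := D_zpow hd (mu_mem L x) hc n (D_conj _ h2)
  simp [h3]
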